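/- arXiv:2210.09516 — 2 statements merged into one kernel-verified Lean document; each statement's English description precedes it below -/
import Mathlib

section
/- Let τ be a smooth involution of the circle S¹, that is, a smooth map with τ ∘ τ = id. If τ is not the identity, then the fixed-point set of τ is either empty or consists of exactly two points. -/
open Metric Manifold Topology

/-- A continuous involution of the real line is the identity or has exactly one fixed point. -/
theorem Function.Involutive.eq_id_or_existsUnique_isFixedPt {f : ℝ → ℝ}
    (hf : Function.Involutive f) (hc : Continuous f) :
    f = id ∨ ∃! x, Function.IsFixedPt f x := by
  rcases hc.strictMono_of_inj hf.injective with hmono | hanti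
  · left
    funext x
    rcases lt_trichotomy (f x) x with h | h | h
    · have := hmono h
      rw [hf x] at this
      exact absurd h this.not_gt
    · exact h
    · have := hmono h
      rw [hf x] at this
      exact absurd h this.not_gt
  · right
    have hsub : Continuous fun x ↦ x - f x := continuous_id.sub hc
    have hzero : (0 : ℝ) ∈ Set.uIcc (0 - f 0) (f 0 - f (f 0)) := by
      rw [hf 0, Set.mem_uIcc]
      rcases le_total (f 0) 0 with h | h
      · right; constructor <;> linarith
      · left; constructor <;> linarith
    obtain ⟨x, -, hx⟩ := intermediate_value_uIcc hsub.continuousOn hzero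
    have hx : f x = x := (sub_eq_zero.mp hx).symm
    refine ⟨x, hx, fun y hy ↦ ?_⟩
    have hy : f y = y := hy
    rcases lt_trichotomy y x with h | h | h
    · have := hanti h
      linarith
    · exact h
    · have := hanti h
      linarith

/-- The complement of a point of the circle is homeomorphic to the real line. -/
theorem nonempty_homeomorph_compl_singleton_real
    (p : sphere (0 : EuclideanSpace ℝ (Fin 2)) 1) :
    Nonempty (({p}ᶜ : Set (sphere (0 : EuclideanSpace ℝ (Fin 2)) 1)) ≃ₜ ℝ) := by
  have : Fact (Module.finrank ℝ (EuclideanSpace ℝ (Fin 2)) = 1 + 1) := ⟨by simp⟩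
  let e := stereographic' 1 p
  exact ⟨(Homeomorph.setCongr (stereographic'_source p).symm).trans <|
    e.toHomeomorphSourceTarget.trans <|
    (Homeomorph.setCongr (stereographic'_target p)).trans <|
    (Homeomorph.Set.univ _).trans <|
    (EuclideanSpace.equiv (Fin 1) ℝ).toHomeomorph.trans <|
    Homeomorph.funUnique (Fin 1) ℝ⟩

/-- Let `τ` be a smooth involution of the circle `S¹` (the unit sphere in the
Euclidean plane, with its standard smooth 1-manifold structure), that is, a smooth map with
`τ ∘ τ = id`.  If `τ` is not the identity, then the fixed-point set of `τ` is either empty or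
consists of exactly two points. -/
theorem smooth_involution_circle_fixed_points
    (τ : Metric.sphere (0 : EuclideanSpace ℝ (Fin 2)) 1 →
         Metric.sphere (0 : EuclideanSpace ℝ (Fin 2)) 1)
    (hτ_smooth : ContMDiff (𝓡 1) (𝓡 1) (⊤ : ℕ∞) τ)
    (hτ_invol : τ ∘ τ = id)
    (hτ_ne : τ ≠ id) :
    {x : Metric.sphere (0 : EuclideanSpace ℝ (Fin 2)) 1 | τ x = x} = ∅ ∨
      ∃ a b : Metric.sphere (0 : EuclideanSpace ℝ (Fin 2)) 1, a ≠ b ∧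
        {x : Metric.sphere (0 : EuclideanSpace ℝ (Fin 2)) 1 | τ x = x} = {a, b} := by
  rcases Set.eq_empty_or_nonempty {x | τ x = x} with hempty | ⟨p, hp⟩
  · exact Or.inl hempty
  right
  have hp : τ p = p := hp
  have hinv : Function.Involutive τ := congrFun hτ_invol
  have hmaps : Set.MapsTo τ {p}ᶜ {p}ᶜ := fun x hx h ↦ hx <| by
    rw [Set.mem_singleton_iff] at h ⊢
    rw [← hinv x, h, hp]
  obtain ⟨φ⟩ := nonempty_homeomorph_compl_singleton_real p
  let f : ℝ → ℝ := fun t ↦ φ (hmaps.restrict τ _ _ (φ.symm t))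
  have hfc : Continuous f :=
    φ.continuous.comp ((hτ_smooth.continuous.restrict hmaps).comp φ.symm.continuous)
  have hφ : ∀ x, f (φ x) = φ (hmaps.restrict τ _ _ x) := fun x ↦ by simp [f]
  have hf : Function.Involutive f := fun t ↦ by
    obtain ⟨x, rfl⟩ := φ.surjective t
    rw [hφ, φ.symm_apply_apply]
    exact congrArg φ (Subtype.ext (hinv x))
  have hfix : ∀ x, f (φ x) = φ x ↔ τ x = x := fun x ↦ by
    rw [hφ, φ.injective.eq_iff, Subtype.ext_iff, Set.MapsTo.val_restrict_apply]
  rcases hf.eq_id_or_existsUnique_isFixedPt hfc with hid | ⟨t, ht, huniq⟩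
  · refine absurd (funext fun x ↦ ?_) hτ_ne
    by_cases hx : x = p
    · rw [hx, hp, id]
    · exact (hfix ⟨x, hx⟩).mp (congrFun hid _)
  · obtain ⟨q, rfl⟩ := φ.surjective t
    refine ⟨p, q, fun h ↦ q.2 h.symm, Set.ext fun x ↦ ⟨fun hx ↦ ?_, ?_⟩⟩
    · by_cases hxp : x = p
      · exact Or.inl hxp
      · have := φ.injective (huniq (φ ⟨x, hxp⟩) ((hfix ⟨x, hxp⟩).mpr hx))
        exact Or.inr (congrArg Subtype.val this)
    · rintro (rfl | rfl)
      · exact hp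
      · exact (hfix q).mp ht
end

section
/- Let n ≥ 2 and let Γ be a lattice in SL(n,ℝ), acting on ℝⁿ∖{0} by the restriction of the standard linear action. Then every Γ-invariant Borel measure on ℝⁿ∖{0} of the form f·λ, where λ is Lebesgue measure and f is a smooth positive function, is a constant multiple of λ. In particular, Γ preserves no finite Borel measure on ℝⁿ∖{0} with smooth positive density with respect to Lebesgue measure. -/
open Matrix MeasureTheory ContDiff

/-- The special linear group, as a subset of the space of matrices, carries the subspace
topology. -/
noncomputable instance (n : ℕ) : TopologicalSpace (Matrix.SpecialLinearGroup (Fin n) ℝ) :=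
  instTopologicalSpaceSubtype

open Set Filter Topology Pointwise

section FundamentalDomain

variable {G : Type*} [Group G] [TopologicalSpace G] [IsTopologicalGroup G] [LocallyCompactSpace G]
  [SecondCountableTopology G] [MeasurableSpace G] [BorelSpace G] {μ : Measure G}
  [μ.IsHaarMeasure] {Γ : Subgroup G} [Countable Γ] {D : Set G}

omit [Countable Γ] in
/-- Right translates of a fundamental domain for left multiplication are fundamental domains. -/
theorem MeasureTheory.IsFundamentalDomain.preimage_mul_right (hD : IsFundamentalDomain Γ D μ)
    (h : G) : IsFundamentalDomain Γ ((· * h) ⁻¹' D) μ :=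
  hD.preimage_of_equiv (quasiMeasurePreserving_mul_right μ h) (e := id) Function.bijective_id
    fun γ x => by simp [Subgroup.smul_def, mul_assoc]

/-- A group containing a lattice is unimodular. -/
theorem MeasureTheory.IsFundamentalDomain.map_mul_right_eq_self (hD : IsFundamentalDomain Γ D μ)
    (hfin : μ D ≠ ⊤) (h : G) : μ.map (· * h) = μ := by
  have key := Measure.isMulLeftInvariant_eq_smul (μ.map (· * h)) μ
  set c := Measure.haarScalarFactor (μ.map (· * h)) μ
  have hmeas : μ.map (· * h) D = μ D :=
    ((MeasurableEquiv.mulRight h).map_apply D).trans ((hD.preimage_mul_right h).measure_eq hD)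
  rw [key] at hmeas
  have hD0 : μ D ≠ 0 := hD.measure_ne_zero (NeZero.ne μ)
  have hc : (c : ENNReal) = 1 := by
    rw [Measure.smul_apply, ENNReal.smul_def, smul_eq_mul] at hmeas
    exact (ENNReal.mul_eq_right hD0 hfin).1 hmeas
  rw [key, ENNReal.coe_eq_one.1 hc, one_smul]

theorem MeasureTheory.IsFundamentalDomain.setIntegral_mul_right (hD : IsFundamentalDomain Γ D μ)
    (hfin : μ D ≠ ⊤) {k : G → ℝ} (hk : ∀ γ ∈ Γ, ∀ g, k (γ * g) = k g) (h : G) :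
    ∫ g in D, k (g * h) ∂μ = ∫ g in D, k g ∂μ := by
  have hmp : MeasurePreserving (· * h) μ μ :=
    ⟨measurable_mul_const h, hD.map_mul_right_eq_self hfin h⟩
  rw [← hmp.setIntegral_preimage_emb (MeasurableEquiv.mulRight h).measurableEmbedding k D]
  refine hD.setIntegral_eq (hD.preimage_mul_right h) fun γ g => ?_
  rw [Subgroup.smul_def, smul_eq_mul, mul_assoc, hk _ γ.2]

/-- A nonnegative continuous invariant function whose integral over a fundamental domain vanishes
is identically zero. -/
theorem MeasureTheory.IsFundamentalDomain.eq_zero_of_setIntegral_eq_zero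
    (hD : IsFundamentalDomain Γ D μ) {k : G → ℝ} (hk : ∀ γ ∈ Γ, ∀ g, k (γ * g) = k g)
    (hcont : Continuous k) (hnonneg : 0 ≤ k) (hint : IntegrableOn k D μ)
    (hzero : ∫ g in D, k g ∂μ = 0) : k = 0 := by
  have hae : k =ᵐ[μ.restrict D] 0 := (integral_eq_zero_iff_of_nonneg hnonneg hint).1 hzero
  have hnull : μ ({g | k g ≠ 0} ∩ D) = 0 := by
    rw [← Measure.restrict_apply (isOpen_ne_fun hcont continuous_const).measurableSet]
    exact hae
  have hinv (γ : Γ) : γ • {g | k g ≠ 0} = {g | k g ≠ 0} := by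
    ext g
    rw [mem_smul_set_iff_inv_smul_mem, Subgroup.smul_def, smul_eq_mul, mem_ofPred_eq, mem_ofPred_eq,
      hk _ (γ⁻¹).2]
  exact (hcont.ae_eq_iff_eq μ continuous_zero).1 (hD.measure_zero_of_invariant _ hinv hnull)

end FundamentalDomain

section SpecialLinearGroup

variable {n : ℕ}

instance : IsTopologicalGroup (SpecialLinearGroup (Fin n) ℝ) :=
  Matrix.SpecialLinearGroup.topologicalGroup

theorem Matrix.SpecialLinearGroup.isClosedEmbedding_coe :
    IsClosedEmbedding (fun g : SpecialLinearGroup (Fin n) ℝ =>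
      (g : Matrix (Fin n) (Fin n) ℝ)) :=
  (isClosed_eq continuous_id.matrix_det continuous_const).isClosedEmbedding_subtypeVal

instance : LocallyCompactSpace (SpecialLinearGroup (Fin n) ℝ) :=
  have : LocallyCompactSpace (Matrix (Fin n) (Fin n) ℝ) :=
    inferInstanceAs (LocallyCompactSpace (Fin n → Fin n → ℝ))
  Matrix.SpecialLinearGroup.isClosedEmbedding_coe.locallyCompactSpace

instance : SecondCountableTopology (SpecialLinearGroup (Fin n) ℝ) :=
  have : SecondCountableTopology (Matrix (Fin n) (Fin n) ℝ) :=
    inferInstanceAs (SecondCountableTopology (Fin n → Fin n → ℝ))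
  Matrix.SpecialLinearGroup.isClosedEmbedding_coe.isEmbedding.secondCountableTopology

theorem Matrix.SpecialLinearGroup.continuous_mulVec (v : Fin n → ℝ) :
    Continuous fun g : SpecialLinearGroup (Fin n) ℝ => (g : Matrix (Fin n) (Fin n) ℝ) *ᵥ v :=
  isClosedEmbedding_coe.continuous.matrix_mulVec continuous_const

theorem Matrix.SpecialLinearGroup.mul_mulVec (g h : SpecialLinearGroup (Fin n) ℝ)
    (v : Fin n → ℝ) : ((g * h : SpecialLinearGroup (Fin n) ℝ) : Matrix (Fin n) (Fin n) ℝ) *ᵥ v =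
      (g : Matrix (Fin n) (Fin n) ℝ) *ᵥ ((h : Matrix (Fin n) (Fin n) ℝ) *ᵥ v) := by
  rw [coe_mul, mulVec_mulVec]

theorem Matrix.SpecialLinearGroup.mulVec_ne_zero (g : SpecialLinearGroup (Fin n) ℝ)
    {v : Fin n → ℝ} (hv : v ≠ 0) :
    (g : Matrix (Fin n) (Fin n) ℝ) *ᵥ v ≠ 0 := by
  intro h
  apply hv
  have : ((g⁻¹ * g : SpecialLinearGroup (Fin n) ℝ) : Matrix (Fin n) (Fin n) ℝ) *ᵥ v = 0 := by
    rw [coe_mul, ← mulVec_mulVec, h, mulVec_zero]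
  simpa using this

/-- A transvection fixing `v` translates any vector not collinear with `v` along `v`. -/
theorem Matrix.SpecialLinearGroup.exists_mulVec_eq_add_smul {v w : Fin n → ℝ} (hv : v ≠ 0)
    (hw : ∀ c : ℝ, w ≠ c • v) (s : ℝ) : ∃ h : SpecialLinearGroup (Fin n) ℝ,
      (h : Matrix (Fin n) (Fin n) ℝ) *ᵥ v = v ∧
      (h : Matrix (Fin n) (Fin n) ℝ) *ᵥ w = w + s • v := by
  obtain ⟨l, hFv, hFw⟩ : ∃ l : Fin n → ℝ, l ⬝ᵥ v = 0 ∧ l ⬝ᵥ w ≠ 0 := by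
    have hvv : v ⬝ᵥ v ≠ 0 := mt dotProduct_self_eq_zero.1 hv
    set l := w - ((w ⬝ᵥ v) / (v ⬝ᵥ v)) • v with hl
    have hlv : l ⬝ᵥ v = 0 := by
      rw [hl, sub_dotProduct, smul_dotProduct, smul_eq_mul, div_mul_cancel₀ _ hvv, sub_self]
    refine ⟨l, hlv, fun hlw => hw _ (sub_eq_zero.1 (dotProduct_self_eq_zero.1 (?_ : l ⬝ᵥ l = 0)))⟩
    nth_rewrite 2 [hl]
    rw [dotProduct_sub, dotProduct_smul, hlv, hlw, smul_zero, sub_zero]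
  have hdet : (1 + replicateCol Unit ((s / (l ⬝ᵥ w)) • v) * replicateRow Unit l :
      Matrix (Fin n) (Fin n) ℝ).det = 1 := by
    rw [det_one_add_replicateCol_mul_replicateRow, dotProduct_smul, hFv, smul_zero, add_zero]
  have hmul (x : Fin n → ℝ) : (1 + replicateCol Unit ((s / (l ⬝ᵥ w)) • v) * replicateRow Unit l :
      Matrix (Fin n) (Fin n) ℝ) *ᵥ x = x + ((l ⬝ᵥ x) * (s / (l ⬝ᵥ w))) • v := by
    rw [add_mulVec, one_mulVec, ← vecMulVec_eq, vecMulVec_mulVec, op_smul_eq_smul, smul_smul]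
  refine ⟨⟨_, hdet⟩, (hmul v).trans ?_, (hmul w).trans ?_⟩
  · rw [hFv, zero_mul, zero_smul, add_zero]
  · rw [mul_div_cancel₀ _ hFw]

theorem Matrix.SpecialLinearGroup.measurePreserving_mulVec (g : SpecialLinearGroup (Fin n) ℝ) :
    MeasurePreserving (fun v : Fin n → ℝ => (g : Matrix (Fin n) (Fin n) ℝ) *ᵥ v) := by
  refine ⟨(continuous_const.matrix_mulVec continuous_id).measurable, ?_⟩
  have := Real.map_matrix_volume_pi_eq_smul_volume_pi
    (M := (g : Matrix (Fin n) (Fin n) ℝ)) (by rw [g.det_coe]; exact one_ne_zero)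
  rw [g.det_coe, inv_one, abs_one, ENNReal.ofReal_one, one_smul] at this
  exact this

theorem Matrix.SpecialLinearGroup.mulVec_injective (g : SpecialLinearGroup (Fin n) ℝ) :
    Function.Injective fun v : Fin n → ℝ => (g : Matrix (Fin n) (Fin n) ℝ) *ᵥ v := by
  intro v w h
  by_contra hvw
  refine mulVec_ne_zero g (sub_ne_zero.2 hvw) ?_
  rw [mulVec_sub, sub_eq_zero]
  exact h

/-- If a measure with continuous density with respect to Lebesgue measure on `ℝⁿ ∖ {0}` is
invariant under `g ∈ SL(n, ℝ)`, then so is its density. -/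
theorem Matrix.SpecialLinearGroup.density_invariant {f : (Fin n → ℝ) → ℝ}
    (hf : ContinuousOn f {v | v ≠ 0}) (hf_pos : ∀ v : Fin n → ℝ, v ≠ 0 → 0 < f v)
    (g : SpecialLinearGroup (Fin n) ℝ)
    (hinv : ∀ A : Set (Fin n → ℝ), MeasurableSet A →
      ((volume.restrict {v : Fin n → ℝ | v ≠ 0}).withDensity fun v => ENNReal.ofReal (f v))
        ((fun v => (g : Matrix (Fin n) (Fin n) ℝ) *ᵥ v) '' A) =
      ((volume.restrict {v : Fin n → ℝ | v ≠ 0}).withDensity fun v => ENNReal.ofReal (f v)) A)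
    {v : Fin n → ℝ} (hv : v ≠ 0) : f ((g : Matrix (Fin n) (Fin n) ℝ) *ᵥ v) = f v := by
  set T : (Fin n → ℝ) → (Fin n → ℝ) := fun v => (g : Matrix (Fin n) (Fin n) ℝ) *ᵥ v with hT
  set U : Set (Fin n → ℝ) := {v | v ≠ 0} with hU
  have hTcont : Continuous T := continuous_const.matrix_mulVec continuous_id
  have hemb : MeasurableEmbedding T := hTcont.measurableEmbedding (mulVec_injective g)
  have hpre : T ⁻¹' U = U := by
    ext x
    refine ⟨fun hx h0 => hx ?_, fun hx => mulVec_ne_zero g hx⟩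
    rw [hT, h0]
    exact mulVec_zero _
  have hmp : MeasurePreserving T (volume.restrict U) (volume.restrict U) := by
    have := (measurePreserving_mulVec g).restrict_preimage_emb hemb U
    rwa [hpre] at this
  have hmeas : Measurable f := measurable_of_continuousOn_compl_singleton 0 hf
  have hae : (fun v => ENNReal.ofReal (f (T v))) =ᵐ[volume.restrict U]
      fun v => ENNReal.ofReal (f v) := by
    refine ae_eq_of_forall_setLIntegral_eq_of_sigmaFinite
      (hmeas.comp hTcont.measurable).ennreal_ofReal hmeas.ennreal_ofReal fun A hA _ => ?_
    have := hinv A hA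
    rw [withDensity_apply _ hA, withDensity_apply _ (hemb.measurableSet_image.2 hA),
      ← hmp.setLIntegral_comp_emb hemb] at this
    exact this
  have hae' : (f ∘ T) =ᵐ[volume.restrict U] f := by
    filter_upwards [hae, ae_restrict_mem isOpen_ne.measurableSet] with x hx hxU
    exact (ENNReal.ofReal_eq_ofReal_iff (hf_pos _ (mulVec_ne_zero g hxU)).le
      (hf_pos x hxU).le).1 hx
  exact Measure.eqOn_open_of_ae_eq hae' isOpen_ne
    (hf.comp hTcont.continuousOn fun x hx => mulVec_ne_zero g hx) hf hv

/-- The squared `L²` distance over a fundamental domain between the orbit functions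
`g ↦ φ (g w)` and `g ↦ φ (g v)`. -/
noncomputable def orbitDeviation [MeasurableSpace (SpecialLinearGroup (Fin n) ℝ)]
    (ν : Measure (SpecialLinearGroup (Fin n) ℝ)) (D : Set (SpecialLinearGroup (Fin n) ℝ))
    (φ : (Fin n → ℝ) → ℝ) (v w : Fin n → ℝ) : ℝ :=
  ∫ g in D, (φ ((g : Matrix (Fin n) (Fin n) ℝ) *ᵥ w) -
    φ ((g : Matrix (Fin n) (Fin n) ℝ) *ᵥ v)) ^ 2 ∂ν

theorem orbitDeviation_self [MeasurableSpace (SpecialLinearGroup (Fin n) ℝ)]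
    (ν : Measure (SpecialLinearGroup (Fin n) ℝ)) (D : Set (SpecialLinearGroup (Fin n) ℝ))
    (φ : (Fin n → ℝ) → ℝ) (v : Fin n → ℝ) : orbitDeviation ν D φ v v = 0 := by
  simp [orbitDeviation]

variable {φ : (Fin n → ℝ) → ℝ} {v w : Fin n → ℝ}

theorem Matrix.SpecialLinearGroup.continuous_orbit (hφ : ContinuousOn φ {v | v ≠ 0}) (hv : v ≠ 0) :
    Continuous fun g : SpecialLinearGroup (Fin n) ℝ => φ ((g : Matrix (Fin n) (Fin n) ℝ) *ᵥ v) :=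
  hφ.comp_continuous (continuous_mulVec v) fun g => mulVec_ne_zero g hv

theorem sq_sub_le_of_abs_le {a b C : ℝ} (ha : |a| ≤ C) (hb : |b| ≤ C) :
    ‖(a - b) ^ 2‖ ≤ (C + C) ^ 2 := by
  rw [norm_pow, Real.norm_eq_abs]
  gcongr
  exact (abs_sub a b).trans (add_le_add ha hb)

theorem Matrix.SpecialLinearGroup.orbit_mul_left
    {Γ : Subgroup (SpecialLinearGroup (Fin n) ℝ)}
    (hinv : ∀ γ ∈ Γ, ∀ v, v ≠ 0 → φ ((γ : Matrix (Fin n) (Fin n) ℝ) *ᵥ v) = φ v)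
    {γ : SpecialLinearGroup (Fin n) ℝ} (hγ : γ ∈ Γ) (g : SpecialLinearGroup (Fin n) ℝ)
    (hv : v ≠ 0) :
    φ (((γ * g : SpecialLinearGroup (Fin n) ℝ) : Matrix (Fin n) (Fin n) ℝ) *ᵥ v) =
      φ ((g : Matrix (Fin n) (Fin n) ℝ) *ᵥ v) := by
  rw [mul_mulVec, hinv γ hγ _ (mulVec_ne_zero g hv)]

variable [MeasurableSpace (SpecialLinearGroup (Fin n) ℝ)]
  [BorelSpace (SpecialLinearGroup (Fin n) ℝ)]
  {ν : Measure (SpecialLinearGroup (Fin n) ℝ)} {D : Set (SpecialLinearGroup (Fin n) ℝ)} {C : ℝ}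

theorem continuousOn_orbitDeviation (hfin : ν D ≠ ⊤)
    (hφ : ContinuousOn φ {v | v ≠ 0}) (hC : ∀ v, |φ v| ≤ C) (hv : v ≠ 0) :
    ContinuousOn (orbitDeviation ν D φ v) {w | w ≠ 0} := by
  refine continuousOn_of_dominated (bound := fun _ => (C + C) ^ 2) (fun w hw => ?_)
    (fun w _ => .of_forall fun g => sq_sub_le_of_abs_le (hC _) (hC _))
    (integrableOn_const hfin) (.of_forall fun g => ?_)
  · exact (((SpecialLinearGroup.continuous_orbit hφ hw).sub
      (SpecialLinearGroup.continuous_orbit hφ hv)).pow 2).aestronglyMeasurable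
  · refine ((hφ.comp (Continuous.continuousOn ?_) fun w hw =>
      SpecialLinearGroup.mulVec_ne_zero g hw).sub continuousOn_const).pow 2
    exact continuous_const.matrix_mulVec continuous_id

variable [ν.IsHaarMeasure] {Γ : Subgroup (SpecialLinearGroup (Fin n) ℝ)} [Countable Γ]

theorem orbitDeviation_mulVec (hD : IsFundamentalDomain Γ D ν) (hfin : ν D ≠ ⊤)
    (hinv : ∀ γ ∈ Γ, ∀ v, v ≠ 0 → φ ((γ : Matrix (Fin n) (Fin n) ℝ) *ᵥ v) = φ v)
    (hv : v ≠ 0) (hw : w ≠ 0) {h : SpecialLinearGroup (Fin n) ℝ}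
    (hh : (h : Matrix (Fin n) (Fin n) ℝ) *ᵥ v = v) :
    orbitDeviation ν D φ v ((h : Matrix (Fin n) (Fin n) ℝ) *ᵥ w) = orbitDeviation ν D φ v w := by
  refine Eq.trans (integral_congr_ae (.of_forall fun g => ?_))
    (hD.setIntegral_mul_right hfin (k := fun g : SpecialLinearGroup (Fin n) ℝ =>
      (φ ((g : Matrix (Fin n) (Fin n) ℝ) *ᵥ w) - φ ((g : Matrix (Fin n) (Fin n) ℝ) *ᵥ v)) ^ 2)
      (fun γ hγ g => congrArg₂ (fun a b : ℝ => (a - b) ^ 2)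
        (SpecialLinearGroup.orbit_mul_left hinv hγ g hw)
        (SpecialLinearGroup.orbit_mul_left hinv hγ g hv)) h)
  refine congrArg₂ (fun x y : Fin n → ℝ => (φ x - φ y) ^ 2)
    (SpecialLinearGroup.mul_mulVec g h w).symm (Eq.symm ?_)
  rw [SpecialLinearGroup.mul_mulVec, hh]

theorem eq_of_orbitDeviation_eq_zero (hD : IsFundamentalDomain Γ D ν) (hfin : ν D ≠ ⊤)
    (hφ : ContinuousOn φ {v | v ≠ 0}) (hC : ∀ v, |φ v| ≤ C)
    (hinv : ∀ γ ∈ Γ, ∀ v, v ≠ 0 → φ ((γ : Matrix (Fin n) (Fin n) ℝ) *ᵥ v) = φ v)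
    (hv : v ≠ 0) (hw : w ≠ 0) (hzero : orbitDeviation ν D φ v w = 0) : φ w = φ v := by
  have hcont : Continuous fun g : SpecialLinearGroup (Fin n) ℝ =>
      (φ ((g : Matrix (Fin n) (Fin n) ℝ) *ᵥ w) - φ ((g : Matrix (Fin n) (Fin n) ℝ) *ᵥ v)) ^ 2 :=
    ((SpecialLinearGroup.continuous_orbit hφ hw).sub
      (SpecialLinearGroup.continuous_orbit hφ hv)).pow 2
  have key := hD.eq_zero_of_setIntegral_eq_zero
    (fun γ hγ g => congrArg₂ (fun a b : ℝ => (a - b) ^ 2)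
      (SpecialLinearGroup.orbit_mul_left hinv hγ g hw)
      (SpecialLinearGroup.orbit_mul_left hinv hγ g hv))
    hcont (fun g => sq_nonneg _)
    (Integrable.mono' (integrableOn_const hfin) hcont.aestronglyMeasurable
      (.of_forall fun g => sq_sub_le_of_abs_le (hC _) (hC _))) hzero
  simpa [sub_eq_zero] using congrFun key 1

/-- A continuous function on `ℝⁿ ∖ {0}` that is invariant under a lattice of `SL(n, ℝ)` and
bounded is constant. -/
theorem eq_of_lattice_invariant_of_bounded (hn : 2 ≤ n) (hD : IsFundamentalDomain Γ D ν)
    (hfin : ν D ≠ ⊤) (hφ : ContinuousOn φ {v | v ≠ 0}) (hC : ∀ v, |φ v| ≤ C)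
    (hinv : ∀ γ ∈ Γ, ∀ v, v ≠ 0 → φ ((γ : Matrix (Fin n) (Fin n) ℝ) *ᵥ v) = φ v)
    (hv : v ≠ 0) (hw : w ≠ 0) : φ w = φ v := by
  have translate {v w : Fin n → ℝ} (hv : v ≠ 0) (hvw : ∀ c : ℝ, w ≠ c • v) (s : ℝ) :
      orbitDeviation ν D φ v (w + s • v) = orbitDeviation ν D φ v w := by
    obtain ⟨h, hhv, hhw⟩ := SpecialLinearGroup.exists_mulVec_eq_add_smul hv hvw s
    rw [← hhw, orbitDeviation_mulVec hD hfin hinv hv (by simpa using hvw 0) hhv]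
  have limit {v w : Fin n → ℝ} (hv : v ≠ 0) (hvw : ∀ c : ℝ, w ≠ c • v) {a : ℝ} (ha : a ≠ 0) :
      Tendsto (fun ε : ℝ => orbitDeviation ν D φ v (ε • w)) (𝓝[≠] 0)
        (𝓝 (orbitDeviation ν D φ v (a • v))) := by
    have hcont : ContinuousAt (orbitDeviation ν D φ v) (a • v) :=
      (continuousOn_orbitDeviation hfin hφ hC hv).continuousAt
        (isOpen_ne.mem_nhds (smul_ne_zero ha hv))
    have hlin : Tendsto (fun ε : ℝ => ε • w + a • v) (𝓝[≠] 0) (𝓝 (a • v)) := by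
      have : Continuous fun ε : ℝ => ε • w + a • v := by fun_prop
      simpa using (this.tendsto 0).mono_left nhdsWithin_le_nhds
    refine (hcont.tendsto.comp hlin).congr' ?_
    filter_upwards [self_mem_nhdsWithin] with ε hε
    refine translate hv (fun c hc => hvw (ε⁻¹ * c) ?_) a
    rw [mul_smul, ← hc, inv_smul_smul₀ hε]
  have exists_indep {v : Fin n → ℝ} : ∃ w, ∀ c : ℝ, w ≠ c • v := by
    by_contra! hall
    have := finrank_le_one v fun w => (hall w).imp fun _ => Eq.symm
    rw [Module.finrank_fin_fun] at this
    lia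
  have limit_zero {v w : Fin n → ℝ} (hv : v ≠ 0) (hvw : ∀ c : ℝ, w ≠ c • v) :
      Tendsto (fun ε : ℝ => orbitDeviation ν D φ v (ε • w)) (𝓝[≠] 0) (𝓝 0) := by
    simpa only [one_smul, orbitDeviation_self] using limit hv hvw one_ne_zero
  have homogeneous {v : Fin n → ℝ} (hv : v ≠ 0) {a : ℝ} (ha : a ≠ 0) : φ (a • v) = φ v := by
    obtain ⟨w, hvw⟩ := exists_indep (v := v)
    exact eq_of_orbitDeviation_eq_zero hD hfin hφ hC hinv hv (smul_ne_zero ha hv)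
      (tendsto_nhds_unique (limit hv hvw ha) (limit_zero hv hvw))
  by_cases hvw : ∀ c : ℝ, w ≠ c • v
  · refine eq_of_orbitDeviation_eq_zero hD hfin hφ hC hinv hv hw
      (tendsto_nhds_unique (tendsto_const_nhds.congr' ?_) (limit_zero hv hvw))
    filter_upwards [self_mem_nhdsWithin] with ε hε
    refine integral_congr_ae (.of_forall fun g => ?_)
    simp only [mulVec_smul, homogeneous (SpecialLinearGroup.mulVec_ne_zero g hw) hε]
  · push Not at hvw
    obtain ⟨c, rfl⟩ := hvw
    exact homogeneous hv (left_ne_zero_of_smul hw)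

end SpecialLinearGroup

/-- Let `n ≥ 2` and let `Γ` be a lattice in `SL(n,ℝ)` (a discrete subgroup of
finite covolume with respect to Haar measure), acting on `ℝⁿ ∖ {0}` by the restriction of the
standard linear action.  Then every `Γ`-invariant Borel measure on `ℝⁿ ∖ {0}` of the form
`f · λ`, where `λ` is Lebesgue measure and `f` is a smooth positive function, is a constant
multiple of `λ`.  In particular, `Γ` preserves no finite Borel measure on `ℝⁿ ∖ {0}` with
smooth positive density with respect to Lebesgue measure. -/
theorem invariant_smooth_density_is_constant
    (n : ℕ) (hn : 2 ≤ n)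
    [MeasurableSpace (Matrix.SpecialLinearGroup (Fin n) ℝ)]
    [BorelSpace (Matrix.SpecialLinearGroup (Fin n) ℝ)]
    (μH : Measure (Matrix.SpecialLinearGroup (Fin n) ℝ)) [μH.IsHaarMeasure]
    (Γ : Subgroup (Matrix.SpecialLinearGroup (Fin n) ℝ))
    [DiscreteTopology Γ]
    (D : Set (Matrix.SpecialLinearGroup (Fin n) ℝ))
    (hD : MeasureTheory.IsFundamentalDomain Γ D μH) (hDfin : μH D < ⊤)
    (f : (Fin n → ℝ) → ℝ)
    (hf_smooth : ContDiffOn ℝ ∞ f {v : Fin n → ℝ | v ≠ 0})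
    (hf_pos : ∀ v : Fin n → ℝ, v ≠ 0 → 0 < f v)
    (μ : Measure (Fin n → ℝ))
    (hμ : μ = (volume.restrict {v : Fin n → ℝ | v ≠ 0}).withDensity
      fun v => ENNReal.ofReal (f v))
    (hinv : ∀ γ ∈ Γ, ∀ A : Set (Fin n → ℝ), MeasurableSet A →
      μ ((fun v => (γ : Matrix (Fin n) (Fin n) ℝ).mulVec v) '' A) = μ A) :
    (∃ c : ℝ, 0 < c ∧ ∀ v : Fin n → ℝ, v ≠ 0 → f v = c) ∧ ¬ IsFiniteMeasure μ := by
  have : Nontrivial (Fin n → ℝ) :=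
    have : Nonempty (Fin n) := ⟨⟨0, by lia⟩⟩
    inferInstance
  have : Countable Γ := countable_of_Lindelof_of_discrete
  have hcont : ContinuousOn f {v : Fin n → ℝ | v ≠ 0} := hf_smooth.continuousOn
  have hf_inv : ∀ γ ∈ Γ, ∀ v : Fin n → ℝ, v ≠ 0 →
      f ((γ : Matrix (Fin n) (Fin n) ℝ) *ᵥ v) = f v := fun γ hγ v hv =>
    SpecialLinearGroup.density_invariant hcont hf_pos γ (hμ ▸ hinv γ hγ) hv
  have hconst {v w : Fin n → ℝ} (hv : v ≠ 0) (hw : w ≠ 0) : f w = f v :=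
    Real.arctan_injective <| eq_of_lattice_invariant_of_bounded hn hD hDfin.ne
      (φ := fun v => Real.arctan (f v)) (C := Real.pi / 2)
      (Real.continuous_arctan.comp_continuousOn hcont)
      (fun v => abs_le.2
        ⟨(Real.neg_pi_div_two_lt_arctan _).le, (Real.arctan_lt_pi_div_two _).le⟩)
      (fun γ hγ v hv => congrArg Real.arctan (hf_inv γ hγ v hv)) hv hw
  obtain ⟨e, he⟩ := exists_ne (0 : Fin n → ℝ)
  refine ⟨⟨f e, hf_pos e he, fun v hv => hconst he hv⟩, fun hfinite => ?_⟩
  have huniv : μ Set.univ = ENNReal.ofReal (f e) * volume {v : Fin n → ℝ | v ≠ 0} := by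
    rw [hμ, withDensity_apply _ MeasurableSet.univ, Measure.restrict_univ,
      setLIntegral_congr_fun isOpen_ne.measurableSet (g := fun _ => ENNReal.ofReal (f e))
        (fun v hv => by simp only [hconst he hv]), setLIntegral_const]
  have hvol : volume {v : Fin n → ℝ | v ≠ 0} = ⊤ := by
    have : volume ({0}ᶜ : Set (Fin n → ℝ)) = ⊤ := by
      rw [measure_compl (measurableSet_singleton 0) (by simp)]
      simp
    exact this
  rw [hvol, ENNReal.mul_top (by simpa using hf_pos e he)] at huniv
  exact measure_ne_top μ Set.univ huniv
end
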